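/- arXiv:1504.07280 — 7 statements merged into one kernel-verified Lean document; each statement's English description precedes it below -/
import Mathlib

section
/- Let K be a field of characteristic zero, A = K[u_1,…,u_s,v_1,…,v_t], A' = K[u'_1,…,u'_s,v'_1,…,v'_t], and fix 1 ≤ k ≤ s. Let φ : A → A' be the K-algebra homomorphism with φ(u_1)=u'_1, φ(u_i)=u'_1·u'_i for 2 ≤ i ≤ k, φ(u_i)=u'_i for i > k, and φ(v_j)=v'_j for all j (the u_1-chart of the combinatorial blowing-up with centre (u_1=⋯=u_k=0)). Then for any σ_1,…,σ_N ∈ A and every 1 ≤ r ≤ s+t, the ideal of r×r minors of the logarithmic Jacobian matrix of (φ(σ_1),…,φ(σ_N)) (taken in A', with respect to the variables u'_1,…,u'_s,v'_1,…,v'_t) equals the extension under φ of the ideal of r×r minors of the logarithmic Jacobian matrix of (σ_1,…,σ_N). (Chart form of Lemma 2.6(2).) -/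
open Matrix MvPolynomial

/-- The ideal of `r × r` minors of a matrix: the ideal generated by the determinants of all
`r × r` submatrices (obtained by selecting `r` rows and `r` columns). -/
def minorsIdeal {R : Type*} [CommRing R] {m c : Type*} (r : ℕ)
    (M : Matrix m c R) : Ideal R :=
  Ideal.span { d | ∃ (f : Fin r → m) (g : Fin r → c), d = (M.submatrix f g).det }

/-- The logarithmic Jacobian matrix of `σ_1, …, σ_N ∈ K[u_1,…,u_s,v_1,…,v_t]`:
the `N × (s+t)` matrix whose `i`-th row is
`(u_1·∂σ_i/∂u_1, …, u_s·∂σ_i/∂u_s, ∂σ_i/∂v_1, …, ∂σ_i/∂v_t)`. -/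
noncomputable def logJac {K : Type*} [Field K] {s t N : ℕ}
    (σ : Fin N → MvPolynomial (Fin s ⊕ Fin t) K) :
    Matrix (Fin N) (Fin s ⊕ Fin t) (MvPolynomial (Fin s ⊕ Fin t) K) :=
  Matrix.of fun i j =>
    match j with
    | Sum.inl p => X (Sum.inl p) * pderiv (Sum.inl p) (σ i)
    | Sum.inr q => pderiv (Sum.inr q) (σ i)

/-- The `u_1`-chart of the combinatorial blowing-up with centre `(u_1 = ⋯ = u_k = 0)`:
the `K`-algebra homomorphism with `φ(u_1) = u'_1`, `φ(u_i) = u'_1·u'_i` for `2 ≤ i ≤ k`,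
`φ(u_i) = u'_i` for `i > k`, and `φ(v_j) = v'_j` for all `j`. -/
noncomputable def blowupChartU (K : Type*) [Field K] (s t k : ℕ) :
    MvPolynomial (Fin s ⊕ Fin t) K →ₐ[K] MvPolynomial (Fin s ⊕ Fin t) K :=
  aeval fun x =>
    match x with
    | Sum.inl i =>
        if i.val = 0 then X (Sum.inl i)
        else if i.val < k then X (Sum.inl (⟨0, i.pos⟩ : Fin s)) * X (Sum.inl i)
        else X (Sum.inl i)
    | Sum.inr j => X (Sum.inr j)


theorem minorsIdeal_mul_le {R m n c : Type*} [CommRing R] [Fintype n] (r : ℕ)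
    (M : Matrix m n R) (P : Matrix n c R) : minorsIdeal r (M * P) ≤ minorsIdeal r M := by
  classical
  refine Ideal.span_le.2 ?_
  rintro _ ⟨f, g, rfl⟩
  have h : ((M * P).submatrix f g)ᵀ =
      fun j : Fin r => ∑ x : n, P x (g j) • fun i : Fin r => M (f i) x := by
    ext j i
    simp [Matrix.mul_apply, mul_comm]
  have hdet : ((M * P).submatrix f g).det =
      ∑ x : Fin r → n, (∏ j, P (x j) (g j)) * (M.submatrix f x).det := by
    rw [← det_transpose, h]
    refine (detRowAlternating.toMultilinearMap.map_sum
      (fun (j : Fin r) (x : n) => P x (g j) • fun i : Fin r => M (f i) x)).trans ?_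
    refine Finset.sum_congr rfl fun x _ => ?_
    rw [MultilinearMap.map_smul_univ, smul_eq_mul, ← det_transpose (M.submatrix f x)]
    rfl
  rw [SetLike.mem_coe, hdet]
  exact Ideal.sum_mem _ fun x _ => Ideal.mul_mem_left _ _ (Ideal.subset_span ⟨f, x, rfl⟩)

theorem minorsIdeal_mul_eq_of_mul_eq_one {R m n : Type*} [CommRing R] [Fintype n] [DecidableEq n]
    (r : ℕ) (M : Matrix m n R) {P Q : Matrix n n R} (h : P * Q = 1) :
    minorsIdeal r (M * P) = minorsIdeal r M := by
  refine le_antisymm (minorsIdeal_mul_le r M P) ?_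
  simpa [Matrix.mul_assoc, h] using minorsIdeal_mul_le r (M * P) Q

theorem minorsIdeal_map {R S m n : Type*} [CommRing R] [CommRing S] (φ : R →+* S) (r : ℕ)
    (M : Matrix m n R) : minorsIdeal r (M.map φ) = Ideal.map φ (minorsIdeal r M) := by
  rw [minorsIdeal, minorsIdeal, Ideal.map_span]
  congr 1
  ext d
  constructor
  · rintro ⟨f, g, rfl⟩
    exact ⟨_, ⟨f, g, rfl⟩, RingHom.map_det φ _⟩
  · rintro ⟨_, ⟨f, g, rfl⟩, rfl⟩
    exact ⟨f, g, RingHom.map_det φ _⟩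

/-- The derivation giving the `j`-th column of the logarithmic Jacobian matrix. -/
noncomputable def logDerivation (K : Type*) [Field K] {s t : ℕ} (j : Fin s ⊕ Fin t) :
    Derivation K (MvPolynomial (Fin s ⊕ Fin t) K) (MvPolynomial (Fin s ⊕ Fin t) K) :=
  (Sum.elim (fun p => X (Sum.inl p)) (fun _ => 1) j : MvPolynomial (Fin s ⊕ Fin t) K) • pderiv j

theorem logJac_apply {K : Type*} [Field K] {s t N : ℕ}
    (σ : Fin N → MvPolynomial (Fin s ⊕ Fin t) K) (i : Fin N) (j : Fin s ⊕ Fin t) :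
    logJac σ i j = logDerivation K j (σ i) := by
  cases j <;> simp [logJac, logDerivation]

theorem logDerivation_X {K : Type*} [Field K] {s t : ℕ} (j n : Fin s ⊕ Fin t) :
    logDerivation K j (X n) =
      if n = j then Sum.elim (fun p => X (Sum.inl p)) (fun _ => 1) n else 0 := by
  by_cases h : n = j
  · subst h
    simp [logDerivation]
  · simp [logDerivation, pderiv_X_of_ne h, h]

/-- The off-diagonal part of the matrix expressing the logarithmic derivations of the `u_1`-chart
in terms of those of the base: its only nonzero entries are ones in column `u_1`,
in the rows `u_2, …, u_k`. -/
def chartShear (R : Type*) [CommRing R] (s t k : ℕ) :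
    Matrix (Fin s ⊕ Fin t) (Fin s ⊕ Fin t) R :=
  Matrix.of fun m j =>
    if (∃ q : Fin s, m = Sum.inl q ∧ q.val ≠ 0 ∧ q.val < k) ∧ ∃ p : Fin s, j = Sum.inl p ∧ p.val = 0
    then 1 else 0

theorem chartShear_mul_self (R : Type*) [CommRing R] (s t k : ℕ) :
    chartShear R s t k * chartShear R s t k = 0 := by
  ext m j
  rw [Matrix.mul_apply]
  refine Finset.sum_eq_zero fun x _ => ?_
  rcases x with x | x
  · by_cases hx : x.val = 0 <;> simp [chartShear, hx]
  · simp [chartShear]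

theorem logDerivation_blowupChartU_X {K : Type*} [Field K] {s t : ℕ} (k : ℕ)
    (j n : Fin s ⊕ Fin t) :
    logDerivation K j (blowupChartU K s t k (X n)) =
      ∑ m, blowupChartU K s t k (logDerivation K m (X n)) *
        (1 + chartShear (MvPolynomial (Fin s ⊕ Fin t) K) s t k) m j := by
  rw [Finset.sum_eq_single n (fun m _ hm => by simp [logDerivation_X, hm.symm]) (by simp)]
  rw [logDerivation_X, if_pos rfl]
  rcases n with n | n
  · by_cases hn : n.val = 0
    · simp [blowupChartU, hn, logDerivation_X, chartShear, Matrix.one_apply]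
    · by_cases hk : n.val < k
      · have h0 : n ≠ ⟨0, n.pos⟩ := fun h => hn (congrArg Fin.val h)
        rcases j with j | j
        · by_cases hj : j.val = 0
          · obtain rfl : j = ⟨0, n.pos⟩ := Fin.ext hj
            simp [blowupChartU, hn, hk, h0, logDerivation_X, chartShear,
              Derivation.leibniz, mul_comm]
          · have h1 : (⟨0, n.pos⟩ : Fin s) ≠ j := fun h => hj (congrArg Fin.val h).symm
            simp [blowupChartU, hn, hk, hj, h1, logDerivation_X, chartShear, Matrix.one_apply,
              Derivation.leibniz]
        · simp [blowupChartU, hn, hk, logDerivation_X, chartShear, Derivation.leibniz]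
      · simp [blowupChartU, hn, hk, logDerivation_X, chartShear, Matrix.one_apply]
  · simp [blowupChartU, logDerivation_X, chartShear, Matrix.one_apply]

theorem logDerivation_blowupChartU {K : Type*} [Field K] {s t : ℕ} (k : ℕ)
    (j : Fin s ⊕ Fin t) (p : MvPolynomial (Fin s ⊕ Fin t) K) :
    logDerivation K j (blowupChartU K s t k p) =
      ∑ m, blowupChartU K s t k (logDerivation K m p) *
        (1 + chartShear (MvPolynomial (Fin s ⊕ Fin t) K) s t k) m j := by
  induction p using MvPolynomial.induction_on with
  | C a =>
    have hC (m : Fin s ⊕ Fin t) : logDerivation K m (C a) = 0 :=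
      (logDerivation K m).map_algebraMap a
    have hφ : blowupChartU K s t k (C a) = C a := (blowupChartU K s t k).commutes a
    simp [hφ, hC]
  | add p q hp hq => simp only [map_add, hp, hq, add_mul, Finset.sum_add_distrib]
  | mul_X p n hp =>
    simp only [map_mul, Derivation.leibniz, map_add, smul_eq_mul, add_mul, Finset.sum_add_distrib,
      mul_assoc, ← Finset.mul_sum, hp, logDerivation_blowupChartU_X]

theorem logJac_blowupChartU {K : Type*} [Field K] {s t N : ℕ} (k : ℕ)
    (σ : Fin N → MvPolynomial (Fin s ⊕ Fin t) K) :
    (logJac fun i => blowupChartU K s t k (σ i)) =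
      (logJac σ).map (blowupChartU K s t k : _ →+* MvPolynomial (Fin s ⊕ Fin t) K) *
        (1 + chartShear (MvPolynomial (Fin s ⊕ Fin t) K) s t k) := by
  ext i j : 1
  simp [Matrix.mul_apply, logJac_apply, logDerivation_blowupChartU]

/-- The ideals of `r × r` minors of the logarithmic Jacobian matrices transform under the
`u_1`-chart of a combinatorial blowing-up by extension of ideals. -/
theorem minors_logJac_combinatorial_chart {K : Type*} [Field K] [CharZero K]
    {s t N : ℕ} (k : ℕ) (hk1 : 1 ≤ k) (hks : k ≤ s)
    (σ : Fin N → MvPolynomial (Fin s ⊕ Fin t) K)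
    (r : ℕ) (hr1 : 1 ≤ r) (hr : r ≤ s + t) :
    minorsIdeal r (logJac fun i => blowupChartU K s t k (σ i)) =
      Ideal.map (blowupChartU K s t k) (minorsIdeal r (logJac σ)) := by
  have hinv : (1 + chartShear (MvPolynomial (Fin s ⊕ Fin t) K) s t k) *
      (1 - chartShear (MvPolynomial (Fin s ⊕ Fin t) K) s t k) = 1 := by
    rw [add_mul, one_mul, mul_sub, mul_one, chartShear_mul_self]
    abel
  rw [logJac_blowupChartU, minorsIdeal_mul_eq_of_mul_eq_one r _ hinv, minorsIdeal_map]
  rfl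
end

section
/- Let K be a field of characteristic zero, A = K[x_1,…,x_s], and let Ω be the module of Kähler differentials of A over K with universal derivation d : A → Ω. Let β_1,…,β_k, γ ∈ ℕ^s be such that γ is a ℚ-linear combination of β_1,…,β_k (as vectors in ℚ^s) and γ ≥ β_i componentwise for every i. Then d(x^γ) lies in the A-submodule of Ω generated by d(x^{β_1}),…,d(x^{β_k}). (Remark 2.2, consequence.) -/
open MvPolynomial

/-- A product of powers of the variables is the monomial with the corresponding exponent. -/
lemma MvPolynomial.prod_X_pow_eq_monomial_equivFunOnFinite {R σ : Type*} [CommSemiring R]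
    [Fintype σ] (a : σ → ℕ) :
    (∏ p : σ, (X p : MvPolynomial σ R) ^ a p) =
      monomial (Finsupp.equivFunOnFinite.symm a) 1 := by
  rw [monomial_eq, Finsupp.prod_fintype _ _ fun _ => pow_zero _]
  simp

/-- A multiple of the derivative of a monomial, expanded in terms of the derivatives of the
variables; the coefficients depend on the monomials only through their product and `b`. -/
lemma Derivation.monomial_smul_apply_monomial {R σ M : Type*} [CommSemiring R] [Fintype σ]
    [AddCommMonoid M] [Module R M] [Module (MvPolynomial σ R) M]
    [IsScalarTower R (MvPolynomial σ R) M]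
    (D : Derivation R (MvPolynomial σ R) M) (c b : σ →₀ ℕ) :
    monomial c (1 : R) • D (monomial b 1) =
      ∑ p : σ, (b p : R) • monomial (c + b - Finsupp.single p 1) (1 : R) • D (X p) := by
  have hD : D = mkDerivation R fun p => D (X p) := by
    ext p
    simp
  conv_lhs => rw [hD]
  rw [mkDerivation_monomial, one_smul, Finsupp.sum_fintype _ _ (by simp), Finset.smul_sum]
  refine Finset.sum_congr rfl fun p _ => ?_
  obtain hp | hp := Nat.eq_zero_or_pos (b p)
  · simp [hp]
  · have hle : Finsupp.single p 1 ≤ b := Finsupp.single_le_iff.2 hp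
    rw [← mul_smul, monomial_mul, ← add_tsub_assoc_of_le hle, ← smul_assoc, smul_monomial]
    simp

/-- Remark 2.2 (consequence): if `γ` is a ℚ-linear combination of `β_1,…,β_k` and
`γ ≥ β_i` componentwise for every `i`, then `d(x^γ)` lies in the submodule of the Kähler
differentials of `K[x_1,…,x_s]` over `K` generated by `d(x^{β_1}),…,d(x^{β_k})`. -/
theorem d_monomial_mem_span {K : Type*} [Field K] [CharZero K] {s k : ℕ}
    (β : Fin k → Fin s → ℕ) (γ : Fin s → ℕ)
    (hcomb : ∃ q : Fin k → ℚ, ∀ p : Fin s, (γ p : ℚ) = ∑ i : Fin k, q i * (β i p : ℚ))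
    (hge : ∀ (i : Fin k) (p : Fin s), β i p ≤ γ p) :
    KaehlerDifferential.D K (MvPolynomial (Fin s) K) (∏ p : Fin s, X p ^ γ p) ∈
      Submodule.span (MvPolynomial (Fin s) K)
        (Set.range fun i : Fin k =>
          KaehlerDifferential.D K (MvPolynomial (Fin s) K) (∏ p : Fin s, X p ^ β i p)) := by
  obtain ⟨q, hq⟩ := hcomb
  simp only [prod_X_pow_eq_monomial_equivFunOnFinite]
  set D := KaehlerDifferential.D K (MvPolynomial (Fin s) K)
  set g := Finsupp.equivFunOnFinite.symm γ with hg
  set b := fun i => Finsupp.equivFunOnFinite.symm (β i) with hb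
  have hbg (i : Fin k) : b i ≤ g := fun p => hge i p
  have hqK (p : Fin s) : (g p : K) = ∑ i : Fin k, (q i : K) * (b i p : K) := by
    have := congrArg (Rat.cast : ℚ → K) (hq p)
    push_cast at this
    simpa [hg, hb] using this
  have key : D (monomial g 1) =
      ∑ i : Fin k, (q i : K) • monomial (g - b i) (1 : K) • D (monomial (b i) 1) := by
    have h0 := D.monomial_smul_apply_monomial 0 g
    rw [zero_add, monomial_zero', map_one, one_smul] at h0
    simp only [h0, D.monomial_smul_apply_monomial, tsub_add_cancel_of_le (hbg _), hqK,
      Finset.sum_smul, Finset.smul_sum, mul_smul]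
    exact Finset.sum_comm
  rw [key]
  exact Submodule.sum_mem _ fun i _ => Submodule.smul_of_tower_mem _ _ <|
    Submodule.smul_mem _ _ <| Submodule.subset_span ⟨i, rfl⟩
end

section
/- Let K be a field of characteristic zero, A = K[u_1,…,u_s,v_1,…,v_t], n := s+t. Let l ≤ k with k−l ≤ t, let α_1,…,α_l ∈ ℕ^s be linearly independent over ℚ, and let β_1,…,β_{k−l} ∈ ℕ^s be such that the combined family {α_1,…,α_l, β_1,…,β_{k−l}} is totally ordered with respect to the componentwise partial order on ℕ^s. Let M be the k×n matrix over A whose rows are: for each i = 1,…,l, the row (u^{α_i}·α_{i,1}, …, u^{α_i}·α_{i,s}, 0, …, 0), and for each j = 1,…,k−l, the row whose first s entries are (u^{β_j}·v_j·β_{j,1}, …, u^{β_j}·v_j·β_{j,s}), whose (s+j)-th entry is u^{β_j}, and whose other entries are 0 (these are the coefficient vectors of d(u^{α_i}) and d(u^{β_j}v_j) with respect to the logarithmic basis du_1/u_1,…,du_s/u_s, dv_1,…,dv_t). Then for every 1 ≤ m ≤ k, the ideal of m×m minors of M equals the principal ideal generated by u^{γ_m}, where γ_m ∈ ℕ^s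 is the sum of the m smallest elements (with multiplicity) of the totally ordered family {α_i} ∪ {β_j}. (This is the key computation in the proof of the implication (2)⇒(1) of Lemma 3.1/Theorem 1.2: each logarithmic Fitting ideal F_{n−m} is generated by u^{γ_m}.) -/
open Matrix MvPolynomial

/-- The monomial `u^δ = u_1^{δ_1} ⋯ u_s^{δ_s}` in `K[u_1,…,u_s,v_1,…,v_t]`. -/
noncomputable def upow {K : Type*} [Field K] {s t : ℕ} (δ : Fin s → ℕ) :
    MvPolynomial (Fin s ⊕ Fin t) K :=
  ∏ p : Fin s, X (Sum.inl p) ^ δ p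

/-- The `k × (s+t)` matrix whose rows are the coefficient vectors of the differential
monomials `d(u^{α_i})` (`i = 1,…,l`) and `d(u^{β_j} v_j)` (`j = 1,…,k−l`) with respect to
the logarithmic basis `du_1/u_1, …, du_s/u_s, dv_1, …, dv_t`. -/
noncomputable def hpMatrix {K : Type*} [Field K] {s t l m : ℕ} (h : m ≤ t)
    (α : Fin l → Fin s → ℕ) (β : Fin m → Fin s → ℕ) :
    Matrix (Fin l ⊕ Fin m) (Fin s ⊕ Fin t) (MvPolynomial (Fin s ⊕ Fin t) K) :=
  Matrix.of fun i j =>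
    match i, j with
    | Sum.inl i, Sum.inl p => upow (α i) * (α i p : MvPolynomial (Fin s ⊕ Fin t) K)
    | Sum.inl _, Sum.inr _ => 0
    | Sum.inr j, Sum.inl p =>
        upow (β j) * X (Sum.inr (Fin.castLE h j)) * (β j p : MvPolynomial (Fin s ⊕ Fin t) K)
    | Sum.inr j, Sum.inr q => if q = Fin.castLE h j then upow (β j) else 0

theorem upow_sum {K ι : Type*} [Field K] {s t : ℕ} (S : Finset ι) (δ : ι → Fin s → ℕ) :
    (upow (∑ i ∈ S, δ i) : MvPolynomial (Fin s ⊕ Fin t) K) = ∏ i ∈ S, upow (δ i) := by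
  simp only [upow, Finset.sum_apply, ← Finset.prod_pow_eq_pow_sum]
  exact Finset.prod_comm

theorem upow_dvd_upow {K : Type*} [Field K] {s t : ℕ} {γ δ : Fin s → ℕ} (h : γ ≤ δ) :
    (upow γ : MvPolynomial (Fin s ⊕ Fin t) K) ∣ upow δ :=
  Finset.prod_dvd_prod_of_dvd _ _ fun p _ => pow_dvd_pow _ (h p)

/-- The determinant of a product `B * P`, where the rows of `B` are rows of `A`, is a
linear combination of the maximal minors of `B`. -/
theorem det_submatrix_mul_mem_minorsIdeal {R m c : Type*} [CommRing R] [Fintype c] {r : ℕ}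
    (A : Matrix m c R) (f : Fin r → m) (P : Matrix c (Fin r) R) :
    (A.submatrix f id * P).det ∈ minorsIdeal r A := by
  classical
  have hrows : (A.submatrix f id * P)ᵀ = fun j => ∑ p, P p j • fun i => A (f i) p := by
    ext j i
    simp [Matrix.mul_apply, mul_comm]
  have hexpand : (A.submatrix f id * P).det =
      ∑ g : Fin r → c, (∏ j, P (g j) j) * (A.submatrix f g).det := by
    rw [← Matrix.det_transpose, hrows]
    refine ((Matrix.detRowAlternating (n := Fin r) (R := R)).toMultilinearMap.map_sum
      (g := fun j p => P p j • fun i => A (f i) p)).trans (Finset.sum_congr rfl fun g _ => ?_)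
    rw [MultilinearMap.map_smul_univ, smul_eq_mul, ← Matrix.det_transpose (A.submatrix f g)]
    rfl
  rw [hexpand]
  exact Ideal.sum_mem _ fun g _ => Ideal.mul_mem_left _ _ (Ideal.subset_span ⟨f, g, rfl⟩)

theorem Matrix.exists_rightInverse_of_linearIndependent_rows {F m n : Type*} [Field F]
    [Fintype m] [DecidableEq m] [Fintype n] [DecidableEq n] {a : Matrix m n F}
    (ha : LinearIndependent F a.row) : ∃ Q : Matrix n m F, a * Q = 1 := by
  have hinj : Function.Injective (Matrix.toLin' aᵀ) := by
    intro x y hxy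
    simp only [Matrix.toLin'_apply, Matrix.mulVec_transpose] at hxy
    exact Matrix.vecMul_injective_iff.2 ha hxy
  obtain ⟨g, hg⟩ := LinearMap.exists_leftInverse_of_injective _ (LinearMap.ker_eq_bot.2 hinj)
  refine ⟨(LinearMap.toMatrix' g)ᵀ, ?_⟩
  have h := congrArg LinearMap.toMatrix' hg
  rw [LinearMap.toMatrix'_comp, LinearMap.toMatrix'_toLin', LinearMap.toMatrix'_id] at h
  simpa using congrArg Matrix.transpose h

/-- The sum of the first `m` terms of a monotone family is the least among the sums of `m`
distinct terms. -/
theorem sum_castLE_le_sum_of_injective {M : Type*} [AddCommMonoid M] [PartialOrder M]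
    [IsOrderedAddMonoid M] {k m : ℕ} (hm : m ≤ k) {w : Fin k → M} (hw : Monotone w)
    {f : Fin m → Fin k} (hf : Function.Injective f) :
    ∑ i : Fin m, w (Fin.castLE hm i) ≤ ∑ i, w (f i) := by
  have hcard : (Finset.univ.image f).card = m := by
    rw [Finset.card_image_of_injective _ hf, Finset.card_univ, Fintype.card_fin]
  set o := (Finset.univ.image f).orderEmbOfFin hcard with ho
  have hle : ∀ (n : ℕ) (hn : n < m), n ≤ (o ⟨n, hn⟩).val := by
    intro n
    induction n with
    | zero => simp
    | succ n ih =>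
      intro hn
      have h : o ⟨n, by omega⟩ < o ⟨n + 1, hn⟩ := o.strictMono (Fin.mk_lt_mk.2 n.lt_succ_self)
      exact (ih (by omega)).trans_lt h
  have himage : Finset.univ.image o = Finset.univ.image f :=
    Finset.image_orderEmbOfFin_univ _ hcard
  calc ∑ i : Fin m, w (Fin.castLE hm i) ≤ ∑ i, w (o i) :=
        Finset.sum_le_sum fun i _ => hw (hle i.val i.isLt)
    _ = ∑ x ∈ Finset.univ.image o, w x := (Finset.sum_image o.injective.injOn).symm
    _ = ∑ i, w (f i) := by rw [himage, Finset.sum_image hf.injOn]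

theorem sum_filter_val_lt {M : Type*} [AddCommMonoid M] {k m : ℕ} (hm : m ≤ k)
    (w : Fin k → M) :
    ∑ i ∈ Finset.univ.filter (fun i : Fin k => i.val < m), w i =
      ∑ i : Fin m, w (Fin.castLE hm i) := by
  have h : Finset.univ.filter (fun i : Fin k => i.val < m) =
      Finset.univ.map (Fin.castLEEmb hm) := by
    ext i
    simp only [Finset.mem_filter, Finset.mem_univ, true_and, Finset.mem_map]
    exact ⟨fun hi => ⟨⟨i, hi⟩, rfl⟩, by rintro ⟨j, rfl⟩; exact j.isLt⟩
  rw [h, Finset.sum_map]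
  rfl

/-- The matrix obtained from `hpMatrix` by dividing each row by its monomial in `u`. -/
noncomputable def reducedHpMatrix (K : Type*) [Field K] {s t l m : ℕ} (h : m ≤ t)
    (α : Fin l → Fin s → ℕ) (β : Fin m → Fin s → ℕ) :
    Matrix (Fin l ⊕ Fin m) (Fin s ⊕ Fin t) (MvPolynomial (Fin s ⊕ Fin t) K) :=
  Matrix.fromBlocks
    (Matrix.of fun i p => (α i p : MvPolynomial (Fin s ⊕ Fin t) K)) 0
    (Matrix.of fun j p => X (Sum.inr (Fin.castLE h j)) * (β j p : MvPolynomial (Fin s ⊕ Fin t) K))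
    (Matrix.of fun j q => if q = Fin.castLE h j then 1 else 0)

theorem hpMatrix_apply {K : Type*} [Field K] {s t l m : ℕ} (h : m ≤ t)
    (α : Fin l → Fin s → ℕ) (β : Fin m → Fin s → ℕ) (i : Fin l ⊕ Fin m) (j : Fin s ⊕ Fin t) :
    hpMatrix (K := K) h α β i j = upow (Sum.elim α β i) * reducedHpMatrix K h α β i j := by
  rcases i with i | i <;> rcases j with j | j <;>
    simp [hpMatrix, reducedHpMatrix, mul_assoc]

theorem exists_reducedHpMatrix_mul_eq_one {K : Type*} [Field K] [CharZero K]
    {s t l m : ℕ} (h : m ≤ t) {α : Fin l → Fin s → ℕ} (β : Fin m → Fin s → ℕ)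
    (hα : LinearIndependent ℚ fun i : Fin l => fun p : Fin s => (α i p : ℚ)) :
    ∃ P : Matrix (Fin s ⊕ Fin t) (Fin l ⊕ Fin m) (MvPolynomial (Fin s ⊕ Fin t) K),
      reducedHpMatrix K h α β * P = 1 := by
  obtain ⟨Q, hQ⟩ := Matrix.exists_rightInverse_of_linearIndependent_rows
    (a := Matrix.of fun i p => (α i p : ℚ)) hα
  let φ : ℚ →+* MvPolynomial (Fin s ⊕ Fin t) K := C.comp (algebraMap ℚ K)
  have hQ' : (Matrix.of fun i p => (α i p : MvPolynomial (Fin s ⊕ Fin t) K)) * Q.map φ = 1 := by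
    have hmap := congrArg (fun B => B.map φ) hQ
    simp only [Matrix.map_mul] at hmap
    rw [Matrix.map_one _ φ.map_zero φ.map_one] at hmap
    rw [← hmap]
    congr 1
    ext1 i p
    simp
  set D : Matrix (Fin m) (Fin s) (MvPolynomial (Fin s ⊕ Fin t) K) :=
    Matrix.of fun j p => X (Sum.inr (Fin.castLE h j)) * (β j p : MvPolynomial (Fin s ⊕ Fin t) K)
    with hD
  set E : Matrix (Fin m) (Fin t) (MvPolynomial (Fin s ⊕ Fin t) K) :=
    Matrix.of fun j q => if q = Fin.castLE h j then 1 else 0 with hE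
  have hEE : E * Eᵀ = 1 := by
    ext1 i j
    simp [hE, Matrix.mul_apply, Matrix.one_apply, eq_comm]
  refine ⟨Matrix.fromBlocks (Q.map φ) 0 (-(Eᵀ * (D * Q.map φ))) Eᵀ, ?_⟩
  rw [reducedHpMatrix, Matrix.fromBlocks_multiply, hQ', ← hD, ← hE, Matrix.mul_neg E,
    ← Matrix.mul_assoc E, hEE]
  simp

theorem det_submatrix_hpMatrix_mul {K : Type*} [Field K] {s t l m r : ℕ} (h : m ≤ t)
    (α : Fin l → Fin s → ℕ) (β : Fin m → Fin s → ℕ)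
    (P : Matrix (Fin s ⊕ Fin t) (Fin r) (MvPolynomial (Fin s ⊕ Fin t) K))
    (f : Fin r → Fin l ⊕ Fin m) :
    ((hpMatrix (K := K) h α β).submatrix f id * P).det =
      upow (∑ i, Sum.elim α β (f i)) * ((reducedHpMatrix K h α β).submatrix f id * P).det := by
  rw [upow_sum, ← Matrix.det_mul_column]
  congr 1
  ext1 i j
  simp only [Matrix.mul_apply, Matrix.of_apply, Matrix.submatrix_apply, hpMatrix_apply,
    Finset.mul_sum, mul_assoc]

/-- Key computation in the proof of Lemma 3.1 / Theorem 1.2: if `α_1,…,α_l ∈ ℕ^s` are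
ℚ-linearly independent and the combined family `{α_i, β_j}` is totally ordered
componentwise, then for every `1 ≤ m ≤ k` the ideal of `m × m` minors of the matrix of
Hsiang–Pati differential monomials equals the principal ideal generated by `u^{γ_m}`,
where `γ_m` is the sum of the `m` smallest elements (with multiplicity) of the family. -/
theorem minors_hpMatrix_eq_span_monomial {K : Type*} [Field K] [CharZero K]
    {s t k l : ℕ} (hlk : l ≤ k) (hkt : k - l ≤ t)
    (α : Fin l → Fin s → ℕ) (β : Fin (k - l) → Fin s → ℕ)
    (hα : LinearIndependent ℚ fun i : Fin l => fun p : Fin s => (α i p : ℚ))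
    (horder : ∀ a b : Fin l ⊕ Fin (k - l),
        Sum.elim α β a ≤ Sum.elim α β b ∨ Sum.elim α β b ≤ Sum.elim α β a) :
    ∀ e : Fin k ≃ (Fin l ⊕ Fin (k - l)),
      (∀ i j : Fin k, i ≤ j → Sum.elim α β (e i) ≤ Sum.elim α β (e j)) →
      ∀ m : ℕ, 1 ≤ m → m ≤ k →
        minorsIdeal m (hpMatrix (K := K) hkt α β) =
          Ideal.span {upow (K := K) (t := t)
            (∑ i ∈ Finset.univ.filter (fun i : Fin k => i.val < m), Sum.elim α β (e i))} := by
  intro e he m _ hmk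
  rw [sum_filter_val_lt hmk]
  apply le_antisymm
  · refine Ideal.span_le.2 ?_
    rintro _ ⟨f, g, rfl⟩
    refine Ideal.mem_span_singleton.2 ?_
    by_cases hf : Function.Injective f
    · have hle := sum_castLE_le_sum_of_injective hmk (w := fun i => Sum.elim α β (e i))
        (fun i j => he i j) (e.symm.injective.comp hf)
      simp only [Function.comp_apply, Equiv.apply_symm_apply] at hle
      have hdet : ((hpMatrix (K := K) hkt α β).submatrix f g).det =
          upow (∑ i, Sum.elim α β (f i)) * ((reducedHpMatrix K hkt α β).submatrix f g).det := by
        rw [upow_sum, ← Matrix.det_mul_column]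
        congr 1
        ext1 i j
        simp [hpMatrix_apply]
      rw [hdet]
      exact (upow_dvd_upow hle).mul_right _
    · obtain ⟨i, j, hij, hne⟩ := Function.not_injective_iff.1 hf
      rw [Matrix.det_zero_of_row_eq hne (by ext1 p; simp [hij])]
      exact dvd_zero _
  · rw [Ideal.span_singleton_le_iff_mem]
    obtain ⟨P, hP⟩ := exists_reducedHpMatrix_mul_eq_one (K := K) hkt β hα
    let f : Fin m → Fin l ⊕ Fin (k - l) := fun i => e (Fin.castLE hmk i)
    have hf : Function.Injective f := e.injective.comp (Fin.castLE_injective hmk)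
    have hmem := det_submatrix_mul_mem_minorsIdeal (hpMatrix (K := K) hkt α β) f
      (P.submatrix id f)
    rwa [det_submatrix_hpMatrix_mul, ← Matrix.submatrix_mul _ _ f id f
      Function.bijective_id, hP, Matrix.submatrix_one _ hf, Matrix.det_one, mul_one] at hmem
end

section
/- Let K be a field of characteristic zero, A = K[x_1,…,x_s], and let Ω be the module of Kähler differentials of A over K with universal derivation d : A → Ω. Let α_1,…,α_l ∈ ℕ^s and β ∈ ℕ^s, and suppose that β lies in the ℚ-linear span of α_1,…,α_l (as vectors in ℚ^s). Then d(x^{α_1}) ∧ ⋯ ∧ d(x^{α_l}) ∧ d(x^β) = 0 in the exterior algebra of Ω over A. (Case (i) in the proof of Lemma 3.1.) -/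
open MvPolynomial

set_option synthInstance.maxHeartbeats 1000000

open scoped KaehlerDifferential

/-- Monomials are eigenvectors of the Euler operator `X p * ∂/∂X p`. -/
theorem X_mul_pderiv_prod_X_pow {R σ : Type*} [CommSemiring R] [Fintype σ] (γ : σ → ℕ) (p : σ) :
    X p * pderiv p (∏ r, X r ^ γ r : MvPolynomial σ R) =
      C (γ p : R) * ∏ r, X r ^ γ r := by
  have h : (∏ r, X r ^ γ r : MvPolynomial σ R) =
      monomial (Finsupp.equivFunOnFinite.symm γ) 1 := by
    rw [monomial_eq, Finsupp.prod_fintype _ _ (by simp)]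
    simp
  rw [h, X_mul_pderiv_monomial, nsmul_eq_mul]
  simp

/-- A rational linear relation between exponent vectors gives a linear relation between the
differentials of the corresponding monomials. -/
theorem prod_smul_D_monomial_eq_sum {K : Type*} [Field K] [CharZero K] {σ ι : Type*}
    [Fintype σ] [Fintype ι] [DecidableEq ι] (α : ι → σ → ℕ) (β : σ → ℕ) (q : ι → ℚ)
    (hq : ∀ p, (β p : ℚ) = ∑ i, q i * (α i p : ℚ)) :
    (∏ i, ∏ p, X p ^ α i p : MvPolynomial σ K) •
        KaehlerDifferential.D K (MvPolynomial σ K) (∏ p, X p ^ β p) =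
      ∑ i, (C (q i : K) * (∏ p, X p ^ β p) * ∏ j ∈ Finset.univ.erase i, ∏ p, X p ^ α j p) •
        KaehlerDifferential.D K (MvPolynomial σ K) (∏ p, X p ^ α i p) := by
  apply (KaehlerDifferential.mvPolynomialBasis K σ).repr.injective
  ext1 p
  apply mul_left_cancel₀ (X_ne_zero p : (X p : MvPolynomial σ K) ≠ 0)
  have hK : (β p : K) = ∑ i, (q i : K) * (α i p : K) := by
    exact_mod_cast congrArg (Rat.cast (K := K)) (hq p)
  simp only [map_smul, map_sum, Finsupp.smul_apply, Finsupp.finsetSum_apply, smul_eq_mul,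
    KaehlerDifferential.mvPolynomialBasis_repr_apply, Finset.mul_sum]
  rw [mul_left_comm, X_mul_pderiv_prod_X_pow, hK, map_sum, Finset.sum_mul, Finset.mul_sum]
  refine Finset.sum_congr rfl fun i _ => ?_
  rw [mul_left_comm (X p), X_mul_pderiv_prod_X_pow,
    ← Finset.mul_prod_erase Finset.univ _ (Finset.mem_univ i), C_mul]
  ring

/-- Case (i) in the proof of Lemma 3.1: if `β` lies in the ℚ-linear span of `α_1,…,α_l`,
then `d(x^{α_1}) ∧ ⋯ ∧ d(x^{α_l}) ∧ d(x^β) = 0` in the exterior algebra of the module of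
Kähler differentials of `K[x_1,…,x_s]` over `K`. -/
theorem wedge_d_monomials_eq_zero {K : Type*} [Field K] [CharZero K] {s l : ℕ}
    (α : Fin l → Fin s → ℕ) (β : Fin s → ℕ)
    (hspan : ∃ q : Fin l → ℚ, ∀ p : Fin s, (β p : ℚ) = ∑ i : Fin l, q i * (α i p : ℚ)) :
    (List.ofFn fun i : Fin l =>
        ExteriorAlgebra.ι (MvPolynomial (Fin s) K)
          (KaehlerDifferential.D K (MvPolynomial (Fin s) K) (∏ p : Fin s, X p ^ α i p))).prod *
      ExteriorAlgebra.ι (MvPolynomial (Fin s) K)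
        (KaehlerDifferential.D K (MvPolynomial (Fin s) K) (∏ p : Fin s, X p ^ β p)) = 0 := by
  obtain ⟨q, hq⟩ := hspan
  have hrel := prod_smul_D_monomial_eq_sum (K := K) α β q hq
  set v : Fin l → Ω[MvPolynomial (Fin s) K⁄K] := fun i =>
    KaehlerDifferential.D K (MvPolynomial (Fin s) K) (∏ p : Fin s, X p ^ α i p) with hv
  set w := KaehlerDifferential.D K (MvPolynomial (Fin s) K) (∏ p : Fin s, X p ^ β p)
  have hdep : ¬ LinearIndependent (MvPolynomial (Fin s) K)
      (Fin.snoc v w : Fin (l + 1) → Ω[MvPolynomial (Fin s) K⁄K]) := by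
    rw [Fintype.not_linearIndependent_iff]
    refine ⟨Fin.snoc (fun i => C (q i : K) * (∏ p, X p ^ β p) *
      ∏ j ∈ Finset.univ.erase i, ∏ p, X p ^ α j p) (-∏ i, ∏ p, X p ^ α i p), ?_, Fin.last l, ?_⟩
    · simp only [Fin.sum_univ_castSucc, Fin.snoc_castSucc, Fin.snoc_last, neg_smul]
      rw [hrel, add_neg_cancel]
    · rw [Fin.snoc_last, neg_ne_zero]
      exact Finset.prod_ne_zero_iff.mpr fun i _ => Finset.prod_ne_zero_iff.mpr fun p _ =>
        pow_ne_zero _ (X_ne_zero p)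
  have : Module.Free (MvPolynomial (Fin s) K) Ω[MvPolynomial (Fin s) K⁄K] :=
    .of_basis (KaehlerDifferential.mvPolynomialBasis K (Fin s))
  have hzero := congrArg Subtype.val
    ((exteriorPower.ιMulti (MvPolynomial (Fin s) K) (l + 1)).map_linearDependent _ hdep)
  rw [exteriorPower.ιMulti_apply_coe, ExteriorAlgebra.ιMulti_apply, List.ofFn_succ_last] at hzero
  simpa using hzero
end

section
/- Let K be a field of characteristic zero, A = K[x_1,…,x_s], and let Ω be the module of Kähler differentials of A over K with universal derivation d : A → Ω. Let α_1,…,α_l ∈ ℕ^s be linearly independent over ℚ (as vectors in ℚ^s). Then d(x^{α_1}) ∧ ⋯ ∧ d(x^{α_l}) ≠ 0 in the exterior algebra of Ω over A. -/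
open MvPolynomial

namespace MvPolynomial

/-- The derivation `∑ p, c p x_p ∂/∂x_p` multiplies a monomial `x^a` supported in `t` by
`∑ p ∈ t, c p * a p`. -/
theorem mkDerivation_C_mul_X_prod {σ K : Type*} [CommRing K]
    (c : σ → K) (a : σ → ℕ) (t : Finset σ) :
    mkDerivation K (fun p => C (c p) * X p : σ → MvPolynomial σ K) (∏ p ∈ t, X p ^ a p) =
      C (∑ p ∈ t, c p * (a p : K)) * ∏ p ∈ t, X p ^ a p := by
  classical
  induction t using Finset.induction_on with
  | empty => simp
  | insert p t hp ih =>
    have hpow : (a p : MvPolynomial σ K) * X p ^ (a p - 1) * X p =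
        (a p : MvPolynomial σ K) * X p ^ a p := by
      rcases Nat.eq_zero_or_pos (a p) with h | h
      · simp [h]
      · rw [mul_assoc, pow_sub_one_mul h.ne']
    rw [Finset.prod_insert hp, Finset.sum_insert hp, Derivation.leibniz, ih,
      Derivation.leibniz_pow, mkDerivation_X]
    simp only [smul_eq_mul, nsmul_eq_mul, map_add, map_mul, map_natCast]
    linear_combination C (c p) * (∏ q ∈ t, X q ^ a q) * hpow

end MvPolynomial

/-- Linearly independent vectors in `k^s` admit a dual family of linear forms. -/
theorem LinearIndependent.exists_dotProduct_eq_ite {k : Type*} [Field k] {ι σ : Type*}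
    [DecidableEq ι] [Fintype σ] {v : ι → σ → k} (hv : LinearIndependent k v) :
    ∃ c : ι → σ → k, ∀ j i, ∑ p, c j p * v i p = if j = i then 1 else 0 := by
  classical
  obtain ⟨g, hg⟩ := LinearMap.exists_leftInverse_of_injective _
    (LinearMap.ker_eq_bot.2 hv)
  refine ⟨fun j p => g (Pi.single p 1) j, fun j i => ?_⟩
  have h := congrArg (fun x => x j) (LinearMap.congr_fun hg (Finsupp.single i 1))
  simp only [LinearMap.comp_apply, Finsupp.linearCombination_single, one_smul,
    LinearMap.id_apply] at h
  rw [pi_eq_sum_univ' (v i)] at h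
  simp only [map_sum, map_smul, Finsupp.finsetSum_apply, Finsupp.smul_apply, smul_eq_mul,
    Finsupp.single_apply] at h
  simp only [eq_comm (a := j), ← h, Pi.single]
  refine Finset.sum_congr rfl fun p _ => ?_
  rw [mul_comm]

/-- A product in the exterior algebra is nonzero if some linear forms evaluate on the factors
to a matrix with nonzero determinant. -/
theorem ExteriorAlgebra.prod_ofFn_ι_ne_zero_of_det_ne_zero {R M : Type*} [CommRing R]
    [AddCommGroup M] [Module R M] {n : ℕ} {m : Fin n → M} (f : Fin n → M →ₗ[R] R)
    (h : (Matrix.of fun i j => f j (m i)).det ≠ 0) :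
    (List.ofFn fun i => ExteriorAlgebra.ι R (m i)).prod ≠ 0 := by
  intro h0
  rw [← ExteriorAlgebra.ιMulti_apply] at h0
  apply h
  have key := ExteriorAlgebra.liftAlternating_apply_ιMulti
    (Function.update 0 n (Matrix.detRowAlternating.compLinearMap (LinearMap.pi f))) m
  rw [h0, map_zero, Function.update_self] at key
  exact key.symm

/-- If `α_1,…,α_l ∈ ℕ^s` are linearly independent over ℚ, then
`d(x^{α_1}) ∧ ⋯ ∧ d(x^{α_l}) ≠ 0` in the exterior algebra of the module of Kähler
differentials of `K[x_1,…,x_s]` over `K`. -/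
theorem wedge_d_monomials_ne_zero {K : Type*} [Field K] [CharZero K] {s l : ℕ}
    (α : Fin l → Fin s → ℕ)
    (hα : LinearIndependent ℚ fun i : Fin l => fun p : Fin s => (α i p : ℚ)) :
    (List.ofFn fun i : Fin l =>
        ExteriorAlgebra.ι (MvPolynomial (Fin s) K)
          (KaehlerDifferential.D K (MvPolynomial (Fin s) K)
            (∏ p : Fin s, X p ^ α i p))).prod ≠ 0 := by
  obtain ⟨c, hc⟩ := hα.exists_dotProduct_eq_ite
  refine ExteriorAlgebra.prod_ofFn_ι_ne_zero_of_det_ne_zero (fun j =>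
    (mkDerivation K fun p => C (c j p : K) * X p).liftKaehlerDifferential) ?_
  have hdiag : (Matrix.of fun i j => (mkDerivation K fun p =>
      C (c j p : K) * X p).liftKaehlerDifferential (KaehlerDifferential.D K
        (MvPolynomial (Fin s) K) (∏ p : Fin s, X p ^ α i p))) =
      Matrix.diagonal fun i => ∏ p : Fin s, (X p : MvPolynomial (Fin s) K) ^ α i p := by
    ext1 i j
    have hK : ∑ p, (c j p : K) * (α i p : K) = if j = i then 1 else 0 := by
      have h := congrArg (Rat.cast : ℚ → K) (hc j i)
      simpa [apply_ite (Rat.cast : ℚ → K)] using h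
    rw [Matrix.of_apply, Derivation.liftKaehlerDifferential_comp_D,
      mkDerivation_C_mul_X_prod, hK, Matrix.diagonal_apply]
    by_cases h : i = j
    · simp [h]
    · simp [h, Ne.symm h]
  rw [hdiag, Matrix.det_diagonal]
  exact Finset.prod_ne_zero_iff.2 fun i _ => Finset.prod_ne_zero_iff.2 fun p _ =>
    pow_ne_zero _ (X_ne_zero p)
end

section
/- Let A = ℚ[u,v,w] and let σ_1 = u², σ_2 = u³v² + u⁴w (= u³(v² + uw)), σ_3 = u⁴v. Let L be the 3×3 matrix over A whose i-th row is (u·∂σ_i/∂u, ∂σ_i/∂v, ∂σ_i/∂w) (the logarithmic Jacobian matrix of σ with exceptional divisor (u=0)). Then the ideal of 2×2 minors of L equals the ideal of A generated by u⁶ and u⁵v, i.e. the logarithmic Fitting ideal F_1(σ) equals u⁵·(u,v). (Example 1.4.) -/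
open Matrix MvPolynomial

/-- Example 1.4: `σ_1 = u²`, `σ_2 = u³v² + u⁴w`, `σ_3 = u⁴v` (with `u = X 0`, `v = X 1`,
`w = X 2`). -/
noncomputable def σEx : Fin 3 → MvPolynomial (Fin 3) ℚ :=
  ![X 0 ^ 2, X 0 ^ 3 * X 1 ^ 2 + X 0 ^ 4 * X 2, X 0 ^ 4 * X 1]

/-- The logarithmic Jacobian matrix of `σEx`, with exceptional divisor `(u = 0)`:
the `i`-th row is `(u·∂σ_i/∂u, ∂σ_i/∂v, ∂σ_i/∂w)`. -/
noncomputable def logJacEx : Matrix (Fin 3) (Fin 3) (MvPolynomial (Fin 3) ℚ) :=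
  Matrix.of fun i => ![X 0 * pderiv 0 (σEx i), pderiv 1 (σEx i), pderiv 2 (σEx i)]

theorem logJacEx_eq : logJacEx =
    !![2 * X 0 ^ 2, 0, 0;
      3 * X 0 ^ 3 * X 1 ^ 2 + 4 * X 0 ^ 4 * X 2, 2 * X 0 ^ 3 * X 1, X 0 ^ 4;
      4 * X 0 ^ 4 * X 1, X 0 ^ 4, 0] := by
  ext1 i j
  fin_cases i <;> fin_cases j <;>
    simp [logJacEx, σEx, pderiv_X] <;> ring

/-- The products of entries of `logJacEx` in distinct rows and distinct columns already lie in
`(u⁶, u⁵v)`. -/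
theorem logJacEx_mul_mem {i j k l : Fin 3} (hij : i < j) (hkl : k ≠ l) :
    logJacEx i k * logJacEx j l ∈
      Ideal.span {(X 0 : MvPolynomial (Fin 3) ℚ) ^ 6, X 0 ^ 5 * X 1} := by
  rw [logJacEx_eq, Ideal.mem_span_pair]
  fin_cases i <;> fin_cases j <;> first | (exact absurd hij (by decide)) | skip
  all_goals fin_cases k <;> fin_cases l <;> first | (exact absurd rfl hkl) | skip
  all_goals simp
  all_goals first
    | exact ⟨0, 0, by ring1⟩
    | exact ⟨0, 4, by ring1⟩
    | exact ⟨2, 0, by ring1⟩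
    | exact ⟨3 * X 0 * X 1 ^ 2 + 4 * X 0 ^ 2 * X 2, 0, by ring1⟩
    | exact ⟨8 * X 0 * X 1 ^ 2, 0, by ring1⟩
    | exact ⟨4 * X 0 ^ 2 * X 1, 0, by ring1⟩
    | exact ⟨X 0 ^ 2, 0, by ring1⟩

theorem logJacEx_minor_mem {i j : Fin 3} (hij : i < j) (k l : Fin 3) :
    logJacEx i k * logJacEx j l - logJacEx i l * logJacEx j k ∈
      Ideal.span {(X 0 : MvPolynomial (Fin 3) ℚ) ^ 6, X 0 ^ 5 * X 1} := by
  obtain rfl | hkl := eq_or_ne k l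
  · simp
  · exact sub_mem (logJacEx_mul_mem hij hkl) (logJacEx_mul_mem hij hkl.symm)

/-- Example 1.4: the logarithmic Fitting ideal `F_1(σ)`, i.e. the ideal of `2 × 2` minors
of the logarithmic Jacobian matrix, equals `(u⁶, u⁵v) = u⁵·(u,v)`. -/
theorem F1_example : minorsIdeal 2 logJacEx =
    Ideal.span {(X 0 : MvPolynomial (Fin 3) ℚ) ^ 6, X 0 ^ 5 * X 1} := by
  apply le_antisymm
  · refine Ideal.span_le.2 ?_
    rintro _ ⟨f, g, rfl⟩
    rw [SetLike.mem_coe, det_fin_two]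
    simp only [submatrix_apply]
    obtain h | h | h := lt_trichotomy (f 0) (f 1)
    · exact logJacEx_minor_mem h _ _
    · convert Ideal.zero_mem _ using 1
      rw [h]
      ring
    · convert logJacEx_minor_mem h (g 1) (g 0) using 1
      ring
  · have minor_mem (i j k l : Fin 3) :
        logJacEx i k * logJacEx j l - logJacEx i l * logJacEx j k ∈ minorsIdeal 2 logJacEx :=
      Ideal.subset_span ⟨![i, j], ![k, l], by rw [det_fin_two]; rfl⟩
    have inv_mul (q : ℚ) (hq : q ≠ 0) (p : MvPolynomial (Fin 3) ℚ) :
        C q⁻¹ * (C q * p) = p := by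
      rw [← mul_assoc, ← C_mul, inv_mul_cancel₀ hq, C_1, one_mul]
    rw [Ideal.span_le, Set.insert_subset_iff, Set.singleton_subset_iff]
    constructor
    · rw [SetLike.mem_coe, ← inv_mul 2 two_ne_zero (X 0 ^ 6)]
      refine Ideal.mul_mem_left _ _ ?_
      convert minor_mem 0 1 0 2 using 1
      simp [logJacEx_eq, map_ofNat C 2]
      ring
    · rw [SetLike.mem_coe, ← inv_mul 4 four_ne_zero (X 0 ^ 5 * X 1)]
      refine Ideal.mul_mem_left _ _ ?_
      convert minor_mem 0 1 0 1 using 1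
      simp [logJacEx_eq, map_ofNat C 4]
      ring
end

section
/- Let R be the localization of the polynomial ring ℚ[u,v,w] at the maximal ideal (u,v,w). Then the ideal of R generated by (the images of) u⁶ and u⁵v is not a principal ideal. (This is the content of Example 1.4's refutation of the claims of Pati and Taalman: the logarithmic Fitting ideal F_1(σ) of the morphism σ = (u², u³(v²+uw), u⁴v) is not principal at the 1-point a = 0.) -/
open MvPolynomial

/-- The maximal ideal `(u, v, w)` of `ℚ[u,v,w]` (with `u = X 0`, `v = X 1`, `w = X 2`). -/
noncomputable def Pmax : Ideal (MvPolynomial (Fin 3) ℚ) :=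
  Ideal.span {X 0, X 1, X 2}

theorem Pmax_eq_ker :
    Pmax = RingHom.ker (constantCoeff : MvPolynomial (Fin 3) ℚ →+* ℚ) := by
  have himg : ({X 0, X 1, X 2} : Set (MvPolynomial (Fin 3) ℚ)) = X '' Set.univ := by
    ext f
    simp only [Set.image_univ, Set.mem_range, Set.mem_insert_iff, Set.mem_singleton_iff]
    constructor
    · rintro (rfl | rfl | rfl)
      exacts [⟨0, rfl⟩, ⟨1, rfl⟩, ⟨2, rfl⟩]
    · rintro ⟨i, rfl⟩
      fin_cases i <;> simp
  ext f
  rw [Pmax, himg, MvPolynomial.mem_ideal_span_X_image, RingHom.mem_ker]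
  constructor
  · intro h
    by_contra hc
    have h0 : (0 : (Fin 3) →₀ ℕ) ∈ f.support := by
      rw [MvPolynomial.mem_support_iff]
      simpa [MvPolynomial.constantCoeff_eq] using hc
    obtain ⟨i, -, hi⟩ := h 0 h0
    simp at hi
  · intro h m hm
    have hm0 : m ≠ 0 := by
      rintro rfl
      rw [MvPolynomial.mem_support_iff] at hm
      exact hm (by simpa [MvPolynomial.constantCoeff_eq] using h)
    obtain ⟨i, hi⟩ := Finsupp.ne_iff.mp hm0
    exact ⟨i, Set.mem_univ i, by simpa using hi⟩

instance : Pmax.IsPrime := Pmax_eq_ker ▸ RingHom.ker_isPrime _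

/-- In a local domain, if `(c * a, c * b)` is principal with `c ≠ 0`, then one of `a`, `b` divides
the other. -/
theorem dvd_or_dvd_of_isPrincipal_span_pair_mul {R : Type*} [CommRing R] [IsDomain R]
    [IsLocalRing R] {a b c : R} (hc : c ≠ 0)
    (h : (Ideal.span ({c * a, c * b} : Set R)).IsPrincipal) : a ∣ b ∨ b ∣ a := by
  obtain ⟨g, hg⟩ := h
  rw [Ideal.submodule_span_eq] at hg
  have hgmem : g ∈ Ideal.span ({c * a, c * b} : Set R) :=
    hg ▸ Ideal.mem_span_singleton_self g
  obtain ⟨x, y, hxy⟩ := Ideal.mem_span_pair.mp hgmem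
  obtain ⟨s, hs⟩ : g ∣ c * a :=
    Ideal.mem_span_singleton.mp (hg ▸ Ideal.subset_span (by simp))
  obtain ⟨t, ht⟩ : g ∣ c * b :=
    Ideal.mem_span_singleton.mp (hg ▸ Ideal.subset_span (by simp))
  rcases eq_or_ne g 0 with rfl | hg0
  · left
    have hb : b = 0 := by simpa [hc] using ht
    simp [hb]
  · have hst : x * s + y * t = 1 :=
      mul_left_cancel₀ hg0 (by linear_combination hxy - x * hs - y * ht)
    rcases IsLocalRing.isUnit_or_isUnit_of_add_one hst with h | h
    · left
      refine (mul_dvd_mul_iff_left hc).mp ?_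
      rw [hs, ht, (isUnit_of_mul_isUnit_right h).mul_right_dvd]
      exact dvd_mul_right g t
    · right
      refine (mul_dvd_mul_iff_left hc).mp ?_
      rw [hs, ht, (isUnit_of_mul_isUnit_right h).mul_right_dvd]
      exact dvd_mul_right g s

/-- A prime element of a prime ideal `P` that divides `x` in the localization at `P` already
divides `x`. -/
theorem Prime.dvd_of_algebraMap_dvd_atPrime {R : Type*} [CommRing R] [IsDomain R]
    {P : Ideal R} [P.IsPrime] {p x : R} (hp : Prime p) (hpP : p ∈ P)
    (h : algebraMap R (Localization.AtPrime P) p ∣ algebraMap R (Localization.AtPrime P) x) :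
    p ∣ x := by
  obtain ⟨z, hz⟩ := h
  obtain ⟨⟨r, s⟩, hrs⟩ := IsLocalization.surj P.primeCompl z
  have hinj : Function.Injective (algebraMap R (Localization.AtPrime P)) :=
    IsLocalization.injective _ P.primeCompl_le_nonZeroDivisors
  have key : x * s = p * r := hinj (by rw [map_mul, map_mul, hz, mul_assoc, hrs])
  rcases hp.dvd_or_dvd ⟨r, key⟩ with h | h
  · exact h
  · exact absurd (P.mem_of_dvd h hpP) s.2

/-- Example 1.4: in the localization of `ℚ[u,v,w]` at the maximal ideal `(u,v,w)`,
the ideal generated by (the images of) `u⁶` and `u⁵v` is not principal.  (So the logarithmic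
Fitting ideal `F_1(σ)` of `σ = (u², u³(v²+uw), u⁴v)` is not principal at the 1-point `0`.) -/
theorem span_u6_u5v_not_principal :
    ¬ (Ideal.span
        ({algebraMap (MvPolynomial (Fin 3) ℚ) (Localization.AtPrime Pmax) (X 0 ^ 6),
          algebraMap (MvPolynomial (Fin 3) ℚ) (Localization.AtPrime Pmax)
            (X 0 ^ 5 * X 1)} : Set (Localization.AtPrime Pmax))).IsPrincipal := by
  intro h
  have hinj : Function.Injective
      (algebraMap (MvPolynomial (Fin 3) ℚ) (Localization.AtPrime Pmax)) :=
    IsLocalization.injective _ Pmax.primeCompl_le_nonZeroDivisors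
  have : IsDomain (Localization.AtPrime Pmax) :=
    IsLocalization.isDomain_localization Pmax.primeCompl_le_nonZeroDivisors
  rw [pow_succ, map_mul, map_mul] at h
  have hc : algebraMap (MvPolynomial (Fin 3) ℚ) (Localization.AtPrime Pmax) (X 0 ^ 5) ≠ 0 :=
    (map_ne_zero_iff _ hinj).mpr (pow_ne_zero _ (X_ne_zero _))
  rcases dvd_or_dvd_of_isPrincipal_span_pair_mul hc h with h | h
  · have := X_prime.dvd_of_algebraMap_dvd_atPrime (P := Pmax) (Ideal.subset_span (by simp)) h
    simp [X_dvd_X] at this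
  · have := X_prime.dvd_of_algebraMap_dvd_atPrime (P := Pmax) (Ideal.subset_span (by simp)) h
    simp [X_dvd_X] at this
end
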